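/- With the generic frequency-domain parameterisation of an acyclic process graph G = (V, D), let X, Y, Z ⊆ V be pairwise disjoint subsets. Then the submatrix [S]_{Z,Z} is invertible over 𝕂, and the conditional spectrum [S]_{X,Y|Z} := [S]_{X,Y} − [S]_{X,Z}·[S]_{Z,Z}⁻¹·[S]_{Z,Y} is the zero matrix over 𝕂 if and only if Z d-separates X and Y in G. -/

import Mathlib

open Matrix
open scoped BigOperators

/-- The indeterminates of the generic parameterisation: `φ_{v,w,k}`, `ω_v` and `z`. -/
inductive GVar (V : Type u) : Type u
  | phi (v w : V) (k : ℕ)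
  | omega (v : V)
  | z

/-- The field `𝕂 = ℝ(Φ, Ω, z)`: the field of fractions of the real polynomial ring in all
the indeterminates `φ_{v,w,k}`, `ω_v` and `z`. -/
abbrev GField (V : Type u) : Type u := FractionRing (MvPolynomial (GVar V) ℝ)

/-- The image of an indeterminate in `𝕂`. -/
noncomputable def gv {V : Type*} (i : GVar V) : GField V :=
  algebraMap (MvPolynomial (GVar V) ℝ) (GField V) (MvPolynomial.X i)

/-- The image of a real constant in `𝕂`. -/
noncomputable def gconst {V : Type*} (a : ℝ) : GField V :=
  algebraMap (MvPolynomial (GVar V) ℝ) (GField V) (MvPolynomial.C a)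

/-- The generic lag polynomial `φ_{v,w}(z) = Σ_{k ∈ K(v,w)} φ_{v,w,k}·z^k` in `𝕂`. -/
noncomputable def lagPoly {V : Type*} (Kf : V × V → Finset ℕ) (v w : V) : GField V :=
  ∑ k ∈ Kf (v, w), gv (GVar.phi v w k) * gv GVar.z ^ k

/-- The generic direct transfer matrix `H` with `H_{v,w} = φ_{v,w}(z)/(1 − φ_{w,w}(z))` on
edges and `0` elsewhere. -/
noncomputable def Hmat {V : Type*} [DecidableEq V] (DO : Finset (V × V))
    (Kf : V × V → Finset ℕ) : Matrix V V (GField V) :=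
  fun v w => if (v, w) ∈ DO then lagPoly Kf v w / (1 - lagPoly Kf w w) else 0

/-- The generic internal spectrum: the diagonal matrix with entries
`ω_v/((1 − φ_{v,v}(z))·σ(1 − φ_{v,v}(z)))`. -/
noncomputable def SImat {V : Type*} [DecidableEq V] (Kf : V × V → Finset ℕ)
    (σ : GField V ≃+* GField V) : Matrix V V (GField V) :=
  Matrix.diagonal fun v =>
    gv (GVar.omega v) / ((1 - lagPoly Kf v v) * σ (1 - lagPoly Kf v v))

/-- The generic spectrum `S = ((I − H)ᵀ)⁻¹ · S^I · (I − H*)⁻¹`, where `H*` applies `σ`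
entrywise to `H`. -/
noncomputable def Smat {V : Type*} [Fintype V] [DecidableEq V] (DO : Finset (V × V))
    (Kf : V × V → Finset ℕ) (σ : GField V ≃+* GField V) : Matrix V V (GField V) :=
  ((1 - Hmat DO Kf)ᵀ)⁻¹ * SImat Kf σ * (1 - (Hmat DO Kf).map σ)⁻¹

/-- The list of consecutive-vertex triples `(v_{i-1}, v_i, v_{i+1})` of a list of
vertices; the middle components are exactly the interior vertices. -/
def triples {V : Type*} (p : List V) : List (V × V × V) := p.zip (p.tail.zip p.tail.tail)

/-- The interior vertex `t.2.1` is a collider on the (undirected) path: both adjacent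
edges point into it. -/
def IsColliderTriple {V : Type*} (E : V → V → Prop) (t : V × V × V) : Prop :=
  E t.1 t.2.1 ∧ E t.2.2 t.2.1

/-- An (undirected) path, given as its list of vertices, is blocked by `Z` if it contains
an interior non-collider belonging to `Z`, or an interior collider that is not an ancestor
of any element of `Z`. -/
def Blocked {V : Type*} (E : V → V → Prop) (Z : Finset V) (p : List V) : Prop :=
  ∃ t ∈ triples p,
    (¬ IsColliderTriple E t ∧ t.2.1 ∈ Z) ∨
      (IsColliderTriple E t ∧ ¬ ∃ w ∈ Z, Relation.ReflTransGen E t.2.1 w)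

/-- `Z` d-separates `X` and `Y`: every (undirected) path — a list of distinct vertices in
which consecutive vertices are joined by an edge in one direction or the other — from a
vertex of `X` to a vertex of `Y` is blocked by `Z`. -/
def DSep {V : Type*} (E : V → V → Prop) (X Y Z : Finset V) : Prop :=
  ∀ x ∈ X, ∀ y ∈ Y, ∀ p : List V, p.Nodup →
    p.Chain' (fun a b => E a b ∨ E b a) →
    p.head? = some x → p.getLast? = some y → Blocked E Z p

open Relation in
/-- Open walks, built up from the target `y`. The flag says whether the first edge of the walk
points into its first vertex. -/
inductive Reach {V : Type*} (E : V → V → Prop) (Z : Finset V) (y : V) : V → Bool → Prop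
  | start : Reach E Z y y false
  | toIn {b v : V} {d : Bool} : Reach E Z y b d → b ∉ Z → E b v → Reach E Z y v true
  | toOut {b v : V} : Reach E Z y b false → b ∉ Z → E v b → Reach E Z y v false
  | coll {b v : V} : Reach E Z y b true → (∃ w ∈ Z, ReflTransGen E b w) → E v b →
      Reach E Z y v false

def Conn {V : Type*} (E : V → V → Prop) (Z : Finset V) (x y : V) : Prop := ∃ d, Reach E Z y x d

section Comb
open Relation
variable {V : Type*} {E : V → V → Prop} {Z : Finset V} {w : V}

theorem Reach.trans' {y u v : V} {d : Bool} (h1 : Reach E Z y u false) (h2 : Reach E Z u v d) :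
    Reach E Z y v d := by
  induction h2 with
  | start => exact h1
  | toIn _ hb he ih => exact ih.toIn hb he
  | toOut _ hb he ih => exact ih.toOut hb he
  | coll _ hb he ih => exact ih.coll hb he

theorem sink_rtg (hs : ∀ b, ¬ E w b) {z : V} (h : ReflTransGen E w z) : w = z := by
  rcases h.cases_head with h | ⟨c, hc, _⟩
  · exact h
  · exact absurd hc (hs c)

theorem anc_restrict (hs : ∀ b, ¬ E w b) (hw : w ∉ Z) {v : V}
    (h : ∃ z ∈ Z, ReflTransGen E v z) :
    ∃ z ∈ Z, ReflTransGen (fun a b => E a b ∧ b ≠ w) v z := by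
  obtain ⟨z, hz, h⟩ := h
  refine ⟨z, hz, ?_⟩
  induction h using ReflTransGen.head_induction_on with
  | refl => exact .refl
  | head hac hcz ih =>
    refine ReflTransGen.head ⟨hac, ?_⟩ ih
    rintro rfl
    exact hw (sink_rtg hs hcz ▸ hz)

theorem reach_mono {y v : V} {d : Bool}
    (h : Reach (fun a b => E a b ∧ b ≠ w) Z y v d) : Reach E Z y v d := by
  induction h with
  | start => exact .start
  | toIn _ hb he ih => exact ih.toIn hb he.1
  | toOut _ hb he ih => exact ih.toOut hb he.1
  | coll _ hb he ih =>
    obtain ⟨z, hz, h⟩ := hb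
    exact ih.coll ⟨z, hz, ReflTransGen.mono (fun _ _ h => h.1) _ _ h⟩ he.1

theorem reach_restrict (hs : ∀ b, ¬ E w b) (hw : w ∉ Z) {y v : V} {d : Bool} (hy : y ≠ w)
    (h : Reach E Z y v d) (hv : v ≠ w) : Reach (fun a b => E a b ∧ b ≠ w) Z y v d := by
  induction h with
  | start => exact .start
  | @toIn b v d _ hb he ih =>
    have : b ≠ w := by rintro rfl; exact hs _ he
    exact (ih this).toIn hb ⟨he, hv⟩
  | @toOut b v hr hb he ih =>
    have : b ≠ w := by
      rintro rfl
      cases hr with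
      | start => exact hy rfl
      | toOut _ _ he => exact hs _ he
      | coll _ _ he => exact hs _ he
    exact (ih this).toOut hb ⟨he, this⟩
  | @coll b v _ hb he ih =>
    have : b ≠ w := by
      rintro rfl
      obtain ⟨z, hz, h⟩ := hb
      exact hw (sink_rtg hs h ▸ hz)
    exact (ih this).coll (anc_restrict hs hw hb) ⟨he, this⟩

theorem reach_notin {y v : V} {d : Bool} (h : Reach E Z y v d) (hv : v ∉ Z)
    (hy : y ∈ Z) : False := by
  suffices ∀ {v d}, Reach E Z y v d → v = y ∧ d = false by
    obtain ⟨rfl, _⟩ := this h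
    exact hv hy
  intro v d h
  induction h with
  | start => exact ⟨rfl, rfl⟩
  | toIn _ hb he ih => exact absurd hy (ih.1 ▸ hb)
  | toOut _ hb he ih => exact absurd hy (ih.1 ▸ hb)
  | coll _ hb he ih => simp at ih

theorem conn_A (hs : ∀ b, ¬ E w b) (hw : w ∉ Z) {x y : V} (hx : x ≠ w) (hy : y ≠ w) :
    Conn E Z x y ↔ Conn (fun a b => E a b ∧ b ≠ w) Z x y :=
  ⟨fun ⟨d, h⟩ => ⟨d, reach_restrict hs hw hy h hx⟩, fun ⟨d, h⟩ => ⟨d, reach_mono h⟩⟩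

theorem conn_B (hs : ∀ b, ¬ E w b) (hw : w ∉ Z) {y : V} (hy : y ≠ w) :
    Conn E Z w y ↔ ∃ u, E u w ∧ u ∉ Z ∧ Conn (fun a b => E a b ∧ b ≠ w) Z u y := by
  constructor
  · rintro ⟨d, h⟩
    cases h with
    | start => exact absurd rfl hy
    | @toIn b _ d h hb he =>
      refine ⟨b, he, hb, d, reach_restrict hs hw hy h ?_⟩
      rintro rfl; exact hs _ he
    | toOut _ _ he => exact absurd he (hs _)
    | coll _ _ he => exact absurd he (hs _)
  · rintro ⟨u, he, hu, d, h⟩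
    exact ⟨true, (reach_mono h).toIn hu he⟩

theorem reach_last (hs : ∀ b, ¬ E w b) (hw : w ∉ Z) {x : V} {d : Bool}
    (h : Reach E Z w x d) (hx : x ≠ w) :
    ∃ u, E u w ∧ Reach (fun a b => E a b ∧ b ≠ w) Z u x d := by
  induction h with
  | start => exact absurd rfl hx
  | @toIn b v d _ hb he ih =>
    have : b ≠ w := by rintro rfl; exact hs _ he
    obtain ⟨u, hu, h⟩ := ih this
    exact ⟨u, hu, h.toIn hb ⟨he, hx⟩⟩
  | @toOut b v hr hb he ih =>
    by_cases hbw : b = w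
    · subst hbw
      exact ⟨v, he, .start⟩
    · obtain ⟨u, hu, h⟩ := ih hbw
      exact ⟨u, hu, h.toOut hb ⟨he, hbw⟩⟩
  | @coll b v _ hb he ih =>
    have : b ≠ w := by
      rintro rfl
      obtain ⟨z, hz, h⟩ := hb
      exact hw (sink_rtg hs h ▸ hz)
    obtain ⟨u, hu, h⟩ := ih this
    exact ⟨u, hu, h.coll (anc_restrict hs hw hb) ⟨he, this⟩⟩

theorem conn_C (hs : ∀ b, ¬ E w b) (hw : w ∉ Z) {x : V} (hx : x ≠ w) (hxZ : x ∉ Z) :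
    Conn E Z x w ↔ ∃ u, E u w ∧ u ∉ Z ∧ Conn (fun a b => E a b ∧ b ≠ w) Z x u := by
  constructor
  · rintro ⟨d, h⟩
    obtain ⟨u, hu, h⟩ := reach_last hs hw h hx
    exact ⟨u, hu, fun hZ => reach_notin h hxZ hZ, d, h⟩
  · rintro ⟨u, he, hu, d, h⟩
    exact ⟨d, Reach.trans' (Reach.start.toOut hw he) (reach_mono h)⟩

theorem reach_up {y b : V} {d : Bool} (h : Reach E Z y b d)
    (hb : ¬ ∃ z ∈ Z, ReflTransGen E b z) (hbw : ReflTransGen E b w) :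
    ∃ d, Reach E Z y w d := by
  induction hbw using ReflTransGen.head_induction_on generalizing d with
  | refl => exact ⟨d, h⟩
  | @head a c hac hcz ih =>
    refine ih (d := true) (h.toIn (fun ha => hb ⟨a, ha, .refl⟩) hac) ?_
    rintro ⟨z, hz, hcz⟩
    exact hb ⟨z, hz, hcz.head hac⟩

theorem reach_down {b : V}
    (hb : ¬ ∃ z ∈ Z, ReflTransGen E b z) (hbw : ReflTransGen E b w) :
    Reach E Z w b false := by
  induction hbw using ReflTransGen.head_induction_on with
  | refl => exact .start
  | @head a c hac hcz ih =>
    have hc : ¬ ∃ z ∈ Z, ReflTransGen E c z := by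
      rintro ⟨z, hz, hcz⟩
      exact hb ⟨z, hz, hcz.head hac⟩
    exact (ih hc).toOut (fun ha => hc ⟨c, ha, .refl⟩) hac

theorem reach_insert [DecidableEq V] (hs : ∀ b, ¬ E w b) (hw : w ∉ Z) {y v : V} {d : Bool}
    (hy : y ≠ w) (h : Reach E Z y v d) : Reach E (insert w Z) y v d := by
  induction h with
  | start => exact .start
  | @toIn b v d _ hb he ih =>
    have : b ≠ w := by rintro rfl; exact hs _ he
    exact ih.toIn (by simp [this, hb]) he
  | @toOut b v hr hb he ih =>
    have : b ≠ w := by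
      rintro rfl
      cases hr with
      | start => exact hy rfl
      | toOut _ _ he => exact hs _ he
      | coll _ _ he => exact hs _ he
    exact ih.toOut (by simp [this, hb]) he
  | @coll b v _ hb he ih =>
    obtain ⟨z, hz, h⟩ := hb
    exact ih.coll ⟨z, by simp [hz], h⟩ he

theorem conn_D [DecidableEq V] (hs : ∀ b, ¬ E w b) (hw : w ∉ Z) {x y : V} (hx : x ≠ w)
    (hy : y ≠ w) (hxZ : x ∉ Z) :
    Conn E (insert w Z) x y ↔ Conn E Z x y ∨ (Conn E Z x w ∧ Conn E Z w y) := by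
  constructor
  · rintro ⟨d, h⟩
    suffices Reach E Z y x d ∨ (Reach E Z w x d ∧ ∃ d, Reach E Z y w d) by
      rcases this with h | ⟨h1, h2⟩
      · exact Or.inl ⟨d, h⟩
      · exact Or.inr ⟨⟨d, h1⟩, h2⟩
    clear hx hxZ
    induction h with
    | start => exact Or.inl .start
    | toIn _ hb he ih =>
      rw [Finset.mem_insert, not_or] at hb
      exact ih.imp (fun h => h.toIn hb.2 he) (And.imp_left fun h => h.toIn hb.2 he)
    | toOut _ hb he ih =>
      rw [Finset.mem_insert, not_or] at hb
      exact ih.imp (fun h => h.toOut hb.2 he) (And.imp_left fun h => h.toOut hb.2 he)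
    | @coll b v _ hb he ih =>
      by_cases hA : ∃ z ∈ Z, ReflTransGen E b z
      · exact ih.imp (fun h => h.coll hA he) (And.imp_left fun h => h.coll hA he)
      · have hbw : ReflTransGen E b w := by
          obtain ⟨z, hz, h⟩ := hb
          rcases Finset.mem_insert.1 hz with rfl | hz
          · exact h
          · exact absurd ⟨z, hz, h⟩ hA
        refine Or.inr ⟨(reach_down hA hbw).toOut (fun hb => hA ⟨b, hb, .refl⟩) he, ?_⟩
        rcases ih with ih | ih
        · exact reach_up ih hA hbw
        · exact ih.2
  · rintro (⟨d, h⟩ | ⟨h1, ⟨d, h2⟩⟩)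
    · exact ⟨d, reach_insert hs hw hy h⟩
    · obtain ⟨u, hu, _, d', h⟩ := (conn_C hs hw hx hxZ).1 h1
      have huw : u ≠ w := by rintro rfl; exact hs _ hu
      have h3 := reach_insert hs hw huw (reach_mono h)
      have hd : Reach E Z y w true := by
        cases h2 with
        | start => exact absurd rfl hy
        | toIn h hb he => exact h.toIn hb he
        | toOut _ _ he => exact absurd he (hs _)
        | coll _ _ he => exact absurd he (hs _)
      exact ⟨d', ((reach_insert hs hw hy hd).coll ⟨w, by simp, .refl⟩ hu).trans' h3⟩

end Comb

section Walk
open Relation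
variable {V : Type*} {E : V → V → Prop} {Z : Finset V}

/-- The interior triple `(a, b, c)` is open. -/
def OpenT (E : V → V → Prop) (Z : Finset V) (a b c : V) : Prop :=
  ((E a b ∧ E c b) → ∃ w ∈ Z, ReflTransGen E b w) ∧ (¬ (E a b ∧ E c b) → b ∉ Z)

def WalkOK (E : V → V → Prop) (Z : Finset V) : List V → Prop
  | [] => True
  | [_] => True
  | [a, b] => E a b ∨ E b a
  | a :: b :: c :: l => (E a b ∨ E b a) ∧ OpenT E Z a b c ∧ WalkOK E Z (b :: c :: l)

theorem walkOK_ccc (a b c : V) (l : List V) : WalkOK E Z (a :: b :: c :: l) ↔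
    (E a b ∨ E b a) ∧ OpenT E Z a b c ∧ WalkOK E Z (b :: c :: l) := Iff.rfl

theorem walkOK_iff (p : List V) :
    WalkOK E Z p ↔ p.IsChain (fun a b => E a b ∨ E b a) ∧ ¬ Blocked E Z p := by
  induction p with
  | nil => simp [WalkOK, Blocked, triples]
  | cons a p ih =>
    rcases p with _ | ⟨b, _ | ⟨c, l⟩⟩
    · simp [WalkOK, Blocked, triples]
    · simp [WalkOK, Blocked, triples]
    · have : Blocked E Z (a :: b :: c :: l) ↔ ¬ OpenT E Z a b c ∨ Blocked E Z (b :: c :: l) := by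
        simp only [Blocked, triples, OpenT, IsColliderTriple, List.tail_cons, List.zip_cons_cons,
          List.mem_cons, exists_eq_or_imp]
        refine or_congr ?_ Iff.rfl
        by_cases h1 : E a b ∧ E c b <;> by_cases h2 : ∃ w ∈ Z, ReflTransGen E b w <;>
          simp only [h1, h2] <;> simp
      rw [walkOK_ccc, ih, this, @List.isChain_cons_cons _ _ a]
      tauto

theorem walkOK_tail {a : V} {l : List V} (h : WalkOK E Z (a :: l)) : WalkOK E Z l := by
  rcases l with _ | ⟨b, _ | ⟨c, l⟩⟩
  · trivial
  · trivial
  · exact h.2.2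

theorem walkOK_suffix {l r : List V} (h : WalkOK E Z (l ++ r)) : WalkOK E Z r := by
  induction l with
  | nil => exact h
  | cons a l ih => exact ih (walkOK_tail h)

theorem walkOK_append (l : List V) (a b : V) (r : List V) :
    WalkOK E Z (l ++ a :: b :: r) ↔ WalkOK E Z (l ++ [a, b]) ∧ WalkOK E Z (a :: b :: r) := by
  induction l with
  | nil =>
    rcases r with _ | ⟨c, r⟩ <;> simp [WalkOK]
    try tauto
  | cons x l ih =>
    rcases l with _ | ⟨y, _ | ⟨z, l⟩⟩
    · simp only [List.cons_append, List.nil_append] at ih ⊢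
      rw [walkOK_ccc, ih, walkOK_ccc]; tauto
    · simp only [List.cons_append, List.nil_append] at ih ⊢
      rw [walkOK_ccc, ih, walkOK_ccc x]; tauto
    · simp only [List.cons_append] at ih ⊢
      rw [walkOK_ccc, ih, walkOK_ccc]; tauto

theorem walk_dir (l : List V) (a n : V) (h : WalkOK E Z (a :: n :: l)) (he : E a n) :
    (∃ w ∈ Z, ReflTransGen E a w) ∨
      TransGen E a ((a :: n :: l).getLast (by simp)) := by
  induction l generalizing a n with
  | nil => exact Or.inr (TransGen.single he)
  | cons m l ih =>
    obtain ⟨_, h2, h3⟩ := h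
    by_cases hm : E m n
    · obtain ⟨w, hw, h⟩ := h2.1 ⟨he, hm⟩
      exact Or.inl ⟨w, hw, h.head he⟩
    · have hnm : E n m := by
        rcases l with _ | ⟨k, l⟩
        · exact h3.resolve_right hm
        · exact h3.1.resolve_right hm
      rcases ih n m h3 hnm with ⟨w, hw, h⟩ | h
      · exact Or.inl ⟨w, hw, h.head he⟩
      · refine Or.inr (TransGen.head he ?_)
        simpa using h

theorem exists_dup {l : List V} (h : ¬ l.Nodup) :
    ∃ a l1 l2 l3, l = l1 ++ a :: (l2 ++ a :: l3) := by
  induction l with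
  | nil => simp at h
  | cons x l ih =>
    by_cases hx : x ∈ l
    · obtain ⟨s, t, rfl⟩ := List.append_of_mem hx
      exact ⟨x, [], s, t, rfl⟩
    · have : ¬ l.Nodup := fun hl => h (List.nodup_cons.2 ⟨hx, hl⟩)
      obtain ⟨a, l1, l2, l3, rfl⟩ := ih this
      exact ⟨a, x :: l1, l2, l3, rfl⟩

theorem walk_cut (hac : ∀ v, ¬ TransGen E v v) {a : V} {l1 l2 l3 : List V}
    (h : WalkOK E Z (l1 ++ a :: (l2 ++ a :: l3))) : WalkOK E Z (l1 ++ a :: l3) := by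
  have hE : ∀ {u v}, E u v → ¬ E v u := fun h1 h2 => hac _ ((TransGen.single h1).tail h2)
  have hsuf : WalkOK E Z (a :: l3) := by
    have h' : WalkOK E Z ((l1 ++ a :: l2) ++ a :: l3) := by simpa using h
    exact walkOK_suffix h'
  rcases List.eq_nil_or_concat l1 with rfl | ⟨l1, c, rfl⟩
  · exact hsuf
  rw [List.concat_eq_append, List.append_assoc] at h ⊢
  simp only [List.cons_append, List.nil_append] at h ⊢
  rw [walkOK_append] at h ⊢
  refine ⟨h.1, ?_⟩
  have h2 := h.2
  clear h
  -- first vertex after the first occurrence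
  obtain ⟨n1, r1, hr1⟩ : ∃ n1 r1, l2 ++ a :: l3 = n1 :: r1 := by
    cases l2 with
    | nil => exact ⟨_, _, rfl⟩
    | cons n l2 => exact ⟨_, _, rfl⟩
  have h3 := h2
  rw [hr1] at h3
  have hca : E c a ∨ E a c := h3.1
  rcases l3 with _ | ⟨b, l3⟩
  · exact hca
  refine ⟨hca, ⟨?_, ?_⟩, hsuf⟩
  · rintro ⟨h4, h5⟩
    by_cases hn : E n1 a
    · exact h3.2.1.1 ⟨h4, hn⟩
    · -- follow the directed path
      have h6 : WalkOK E Z (a :: (l2 ++ [a, b])) := by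
        have : WalkOK E Z ((c :: a :: l2) ++ a :: b :: l3) := by simpa using h2
        exact walkOK_tail ((walkOK_append _ _ _ _).1 this).1
      -- drop the final vertex
      have h7 : WalkOK E Z (a :: (l2 ++ [a])) := by
        rcases l2 with _ | ⟨m, l2⟩
        · exact h6.1
        · rcases List.eq_nil_or_concat l2 with rfl | ⟨l2, k, rfl⟩
          · exact ⟨h6.1, h6.2.1, h6.2.2.1⟩
          · have : WalkOK E Z ((a :: m :: l2) ++ k :: a :: [b]) := by simpa using h6
            have := ((walkOK_append _ _ _ _).1 this).1
            simpa using this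
      rcases l2 with _ | ⟨m, l2⟩
      · have h8 : E a a := by
          have : WalkOK E Z [a, a] := h7
          simpa [WalkOK] using this
        exact absurd (TransGen.single h8) (hac a)
      · have hm : m = n1 := by simpa using (List.cons.inj hr1).1
        subst hm
        have h8 : E a m := by
          have := h3.2.2
          rcases r1 with _ | ⟨k, r1⟩
          · exact this.resolve_right hn
          · exact this.1.resolve_right hn
        have h9 := walk_dir (l2 ++ [a]) a m h7 h8
        rcases h9 with h9 | h9
        · exact h9
        · exact absurd (by simpa using h9) (hac a)
  · intro h4
    by_cases hc : E c a
    · have hb : ¬ E b a := fun hb => h4 ⟨hc, hb⟩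
      have : WalkOK E Z ((c :: a :: l2) ++ a :: b :: l3) := by simpa using h2
      have h5 := ((walkOK_append _ _ _ _).1 this).1
      rcases List.eq_nil_or_concat l2 with rfl | ⟨l2, k, rfl⟩
      · have h6 : WalkOK E Z [c, a, a, b] := h5
        exact h6.2.2.2.1.2 fun h => hb h.2
      · have h6 : WalkOK E Z ((c :: a :: l2) ++ k :: a :: [b]) := by simpa using h5
        exact (walkOK_suffix h6).2.1.2 fun h => hb h.2
    · exact h3.2.1.2 fun h => hc h.1

theorem walk_nodup (hac : ∀ v, ¬ TransGen E v v) {x y : V} (n : ℕ) :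
    ∀ p : List V, p.length = n → WalkOK E Z p → p.head? = some x → p.getLast? = some y →
    ∃ p : List V, p.Nodup ∧ WalkOK E Z p ∧ p.head? = some x ∧ p.getLast? = some y := by
  induction n using Nat.strong_induction_on with
  | _ n ih =>
    intro p hn hp hx hy
    by_cases hd : p.Nodup
    · exact ⟨p, hd, hp, hx, hy⟩
    · obtain ⟨a, l1, l2, l3, rfl⟩ := exists_dup hd
      refine ih _ ?_ (l1 ++ a :: l3) rfl (walk_cut hac hp) ?_ ?_
      · subst hn; simp
      · cases l1 <;> simpa using hx
      · rw [← hy]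
        simp [List.getLast?_append, List.getLast?_cons]

theorem reach_list (hac : ∀ v, ¬ TransGen E v v) {y v : V} {d : Bool} (h : Reach E Z y v d) :
    ∃ q, WalkOK E Z (v :: q) ∧ (v :: q).getLast? = some y ∧
      ∀ b r, q = b :: r → if d then E b v else E v b := by
  have hE : ∀ {u v}, E u v → ¬ E v u := fun h1 h2 => hac _ ((TransGen.single h1).tail h2)
  induction h with
  | start => exact ⟨[], trivial, by simp, by simp⟩
  | @toIn b v d _ hb he ih =>
    obtain ⟨q, h1, h2, h3⟩ := ih
    refine ⟨b :: q, ?_, by simpa [List.getLast?_cons] using h2, by simp +contextual [he]⟩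
    rcases q with _ | ⟨c, r⟩
    · exact Or.inr he
    · exact ⟨Or.inr he, ⟨fun h => absurd h.1 (hE he), fun _ => hb⟩, h1⟩
  | @toOut b v hr hb he ih =>
    obtain ⟨q, h1, h2, h3⟩ := ih
    refine ⟨b :: q, ?_, by simpa [List.getLast?_cons] using h2, by simp +contextual [he]⟩
    rcases q with _ | ⟨c, r⟩
    · exact Or.inl he
    · have := h3 c r rfl
      simp only [Bool.false_eq_true, if_false] at this
      exact ⟨Or.inl he, ⟨fun h => absurd h.2 (hE this), fun _ => hb⟩, h1⟩
  | @coll b v _ hb he ih =>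
    obtain ⟨q, h1, h2, h3⟩ := ih
    refine ⟨b :: q, ?_, by simpa [List.getLast?_cons] using h2, by simp +contextual [he]⟩
    rcases q with _ | ⟨c, r⟩
    · exact Or.inl he
    · have := h3 c r rfl
      simp only [if_true] at this
      exact ⟨Or.inl he, ⟨fun h => hb, fun h => absurd ⟨he, this⟩ h⟩, h1⟩

theorem list_reach (hE : ∀ u v, E u v → ¬ E v u) {y : V} (hy : y ∉ Z) (q : List V) (v : V)
    (h : WalkOK E Z (v :: q)) (hl : (v :: q).getLast? = some y) :
    (q = [] → Reach E Z y v false) ∧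
      ∀ b r, q = b :: r → (E b v → Reach E Z y v true) ∧ (E v b → Reach E Z y v false) := by
  induction q generalizing v with
  | nil =>
    simp at hl
    subst hl
    exact ⟨fun _ => .start, by simp⟩
  | cons b q ih =>
    refine ⟨by simp, ?_⟩
    rintro b r ⟨⟩
    have h1 := ih b (walkOK_tail h) (by simpa [List.getLast?_cons] using hl)
    rcases q with _ | ⟨c, r⟩
    · have hb : b = y := by simpa using hl
      subst hb
      exact ⟨fun he => Reach.start.toIn hy he, fun he => Reach.start.toOut hy he⟩
    · obtain ⟨h2, h3⟩ := h1.2 c r rfl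
      have h4 : OpenT E Z v b c := h.2.1
      have h5 : E b c ∨ E c b := by
        have := h.2.2
        rcases r with _ | ⟨k, r⟩
        · exact this
        · exact this.1
      by_cases hvb : E v b ∧ E c b
      · have h6 := (h2 hvb.2).coll (h4.1 hvb) hvb.1
        exact ⟨fun he => absurd he (hE _ _ hvb.1), fun _ => h6⟩
      · have hbZ := h4.2 hvb
        refine ⟨fun he => ?_, fun he => ?_⟩
        · rcases h5 with h5 | h5
          · exact (h3 h5).toIn hbZ he
          · exact (h2 h5).toIn hbZ he
        · have : E b c := h5.resolve_right fun h => hvb ⟨he, h⟩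
          exact (h3 this).toOut hbZ he

theorem dsep_iff (hac : ∀ v, ¬ TransGen E v v) (X Y : Finset V) (hYZ : ∀ y ∈ Y, y ∉ Z) :
    DSep E X Y Z ↔ ∀ x ∈ X, ∀ y ∈ Y, ¬ Conn E Z x y := by
  constructor
  · rintro h x hx y hy ⟨d, hr⟩
    obtain ⟨q, h1, h2, _⟩ := reach_list hac hr
    obtain ⟨p, hp, hw, h3, h4⟩ := walk_nodup hac _ _ rfl h1 (by simp : _ = some x) h2
    rw [walkOK_iff] at hw
    exact hw.2 (h x hx y hy p hp hw.1 h3 h4)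
  · intro h x hx y hy p hp hc h3 h4
    by_contra hB
    have hw : WalkOK E Z p := (walkOK_iff p).2 ⟨hc, hB⟩
    rcases p with _ | ⟨v, q⟩
    · simp at h3
    have : v = x := by simpa using h3
    subst this
    have h5 := list_reach (fun _ _ h1 h2 => hac _ ((TransGen.single h1).tail h2)) (hYZ y hy) q v hw h4
    apply h v hx y hy
    rcases q with _ | ⟨b, r⟩
    · exact ⟨_, h5.1 rfl⟩
    · have : E v b ∨ E b v := by
        rcases r with _ | ⟨k, r⟩
        · exact hw
        · exact hw.1
      rcases this with h6 | h6
      · exact ⟨_, (h5.2 b r rfl).2 h6⟩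
      · exact ⟨_, (h5.2 b r rfl).1 h6⟩

end Walk
section Cond
variable {V : Type*} [DecidableEq V] {K : Type*} [Field K]

/-- `C` is obtained from `S` by eliminating the indices in `Z` one at a time. -/
inductive Cnd (S : Matrix V V K) : Finset V → Matrix V V K → Prop
  | nil : Cnd S ∅ S
  | step {Z : Finset V} {C : Matrix V V K} {z : V} : Cnd S Z C → z ∉ Z → C z z ≠ 0 →
      Cnd S (insert z Z) (fun x y => C x y - C x z * C z y / C z z)

variable {S C : Matrix V V K} {Z : Finset V}

theorem Cnd.vanish (h : Cnd S Z C) : ∀ b ∈ Z, ∀ x, C x b = 0 ∧ C b x = 0 := by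
  induction h with
  | nil => simp
  | step _ hz hC ih =>
    intro b hb x
    rcases Finset.mem_insert.1 hb with rfl | hb
    · constructor <;> field_simp <;> ring
    · simp [ih b hb]

theorem Cnd.row (h : Cnd S Z C) :
    ∃ α : V → V → K, ∀ x y, C x y = S x y - ∑ a ∈ Z, α x a * S a y := by
  induction h with
  | nil => simp
  | @step Z C z _ hz hC ih =>
    obtain ⟨α, hα⟩ := ih
    refine ⟨fun x a => if a = z then C x z / C z z else α x a - C x z / C z z * α z a, ?_⟩
    intro x y
    rw [Finset.sum_insert hz]
    have : ∑ a ∈ Z, (if a = z then C x z / C z z else α x a - C x z / C z z * α z a) * S a y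
        = ∑ a ∈ Z, α x a * S a y - C x z / C z z * ∑ a ∈ Z, α z a * S a y := by
      rw [Finset.mul_sum, ← Finset.sum_sub_distrib]
      refine Finset.sum_congr rfl fun a ha => ?_
      rw [if_neg (by rintro rfl; exact hz ha)]
      ring
    rw [this]
    simp only [if_true]
    rw [mul_div_right_comm, hα x y, hα z y]
    ring

theorem Cnd.col (h : Cnd S Z C) :
    ∃ β : V → V → K, ∀ x y, C x y = S x y - ∑ b ∈ Z, S x b * β b y := by
  induction h with
  | nil => simp
  | @step Z C z _ hz hC ih =>
    obtain ⟨β, hβ⟩ := ih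
    refine ⟨fun b y => if b = z then C z y / C z z else β b y - C z y / C z z * β b z, ?_⟩
    intro x y
    rw [Finset.sum_insert hz]
    have : ∑ b ∈ Z, S x b * (if b = z then C z y / C z z else β b y - C z y / C z z * β b z)
        = ∑ b ∈ Z, S x b * β b y - C z y / C z z * ∑ b ∈ Z, S x b * β b z := by
      rw [Finset.mul_sum, ← Finset.sum_sub_distrib]
      refine Finset.sum_congr rfl fun a ha => ?_
      rw [if_neg (by rintro rfl; exact hz ha)]
      ring
    rw [this]
    simp only [if_true]
    rw [mul_div_assoc, hβ x y, hβ x z]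
    ring

theorem Cnd.inj (h : Cnd S Z C) :
    ∀ v : V → K, (∀ x ∈ Z, ∑ y ∈ Z, S x y * v y = 0) → ∀ y ∈ Z, v y = 0 := by
  induction h with
  | nil => simp
  | @step Z C z h hz hC ih =>
    intro v hv
    obtain ⟨α, hα⟩ := h.row
    have h1 : ∑ y ∈ insert z Z, C z y * v y = 0 := by
      have : ∑ y ∈ insert z Z, C z y * v y = ∑ y ∈ insert z Z, S z y * v y
          - ∑ a ∈ Z, α z a * ∑ y ∈ insert z Z, S a y * v y := by
        simp_rw [Finset.mul_sum]
        rw [Finset.sum_comm, ← Finset.sum_sub_distrib]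
        refine Finset.sum_congr rfl fun y _ => ?_
        rw [hα, sub_mul, Finset.sum_mul]
        simp_rw [mul_assoc]
      rw [this, hv z (by simp), Finset.sum_eq_zero, sub_zero]
      intro a ha
      rw [hv a (by simp [ha]), mul_zero]
    rw [Finset.sum_insert hz, Finset.sum_eq_zero (s := Z), add_zero] at h1
    · have hvz : v z = 0 := (mul_eq_zero.1 h1).resolve_left hC
      intro y hy
      rcases Finset.mem_insert.1 hy with rfl | hy
      · exact hvz
      · refine ih v (fun x hx => ?_) y hy
        have := hv x (by simp [hx])
        rwa [Finset.sum_insert hz, hvz, mul_zero, zero_add] at this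
    · intro y hy
      rw [(h.vanish y hy z).1, zero_mul]

theorem Cnd.fix (h : Cnd S Z C) (W : Finset V) (τ : K →+* K)
    (hτ : ∀ x ∈ W, ∀ y ∈ W, τ (S x y) = S x y) (hZ : Z ⊆ W) :
    ∀ x ∈ W, ∀ y ∈ W, τ (C x y) = C x y := by
  induction h with
  | nil => exact hτ
  | @step Z C z h hz hC ih =>
    rw [Finset.insert_subset_iff] at hZ
    intro x hx y hy
    have ih := ih hZ.2
    simp [ih x hx y hy, ih x hx z hZ.1, ih z hZ.1 y hy, ih z hZ.1 z hZ.1]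

theorem Cnd.isUnit (h : Cnd S Z C) :
    IsUnit (S.submatrix (fun a : {u // u ∈ Z} => (a : V)) (fun b : {u // u ∈ Z} => (b : V))) := by
  rw [← Matrix.mulVec_injective_iff_isUnit]
  refine (injective_iff_map_eq_zero (Matrix.mulVecLin _)).2 fun v hv => ?_
  have key := h.inj (fun y => if hy : y ∈ Z then v ⟨y, hy⟩ else 0) ?_
  · ext y
    simpa using key y y.2
  · intro x hx
    have := congrFun hv ⟨x, hx⟩
    simp only [Matrix.mulVecLin_apply, Matrix.mulVec, dotProduct, Matrix.submatrix_apply,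
      Pi.zero_apply] at this
    rw [← this, ← Finset.sum_coe_sort Z]
    refine Finset.sum_congr rfl fun y _ => ?_
    simp

theorem Cnd.formula (h : Cnd S Z C) (X Y : Finset V) :
    (S.submatrix (fun a : {u // u ∈ X} => (a : V)) (fun b : {u // u ∈ Y} => (b : V)) -
        S.submatrix (fun a : {u // u ∈ X} => (a : V)) (fun b : {u // u ∈ Z} => (b : V)) *
          (S.submatrix (fun a : {u // u ∈ Z} => (a : V)) (fun b : {u // u ∈ Z} => (b : V)))⁻¹ *
          S.submatrix (fun a : {u // u ∈ Z} => (a : V)) (fun b : {u // u ∈ Y} => (b : V))) =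
      C.submatrix (fun a : {u // u ∈ X} => (a : V)) (fun b : {u // u ∈ Y} => (b : V)) := by
  obtain ⟨α, hα⟩ := h.row
  have h1 : S.submatrix (fun a : {u // u ∈ X} => (a : V)) (fun b : {u // u ∈ Z} => (b : V)) =
      (Matrix.of fun (x : {u // u ∈ X}) (a : {u // u ∈ Z}) => α x a) *
      S.submatrix (fun a : {u // u ∈ Z} => (a : V)) (fun b : {u // u ∈ Z} => (b : V)) := by
    ext x b
    have := hα x b
    rw [(h.vanish b b.2 x).1, eq_comm, sub_eq_zero, ← Finset.sum_coe_sort Z] at this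
    simpa [Matrix.mul_apply] using this
  rw [h1, Matrix.mul_assoc _ _ (_⁻¹), Matrix.mul_nonsing_inv _
    ((Matrix.isUnit_iff_isUnit_det _).1 h.isUnit), Matrix.mul_one]
  ext x y
  have := hα x y
  rw [← Finset.sum_coe_sort Z] at this
  simp [Matrix.mul_apply, this]

/-- Linear dependence of rows passes to the conditional matrix. -/
theorem Cnd.lin_row [Fintype V] (h : Cnd S Z C) (x y : V) (c : V → K) (k : K)
    (h1 : ∀ b ∈ Z, S x b = ∑ u, c u * S u b) (h2 : S x y = k + ∑ u, c u * S u y) :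
    C x y = k + ∑ u, c u * C u y := by
  obtain ⟨β, hβ⟩ := h.col
  simp_rw [hβ, mul_sub, Finset.sum_sub_distrib, h2, Finset.mul_sum]
  rw [Finset.sum_comm, add_sub_assoc]
  congr 2
  refine Finset.sum_congr rfl fun b hb => ?_
  rw [h1 b hb, Finset.sum_mul]
  simp_rw [mul_assoc]

theorem Cnd.lin_col [Fintype V] (h : Cnd S Z C) (x y : V) (c : V → K)
    (h1 : ∀ b ∈ Z, S b y = ∑ u, S b u * c u) (h2 : S x y = ∑ u, S x u * c u) :
    C x y = ∑ u, C x u * c u := by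
  obtain ⟨α, hα⟩ := h.row
  simp_rw [hα, sub_mul, Finset.sum_sub_distrib, h2, Finset.sum_mul]
  rw [Finset.sum_comm (s := Finset.univ)]
  congr 1
  refine Finset.sum_congr rfl fun b hb => ?_
  rw [h1 b hb, Finset.mul_sum]
  simp_rw [mul_assoc]

end Cond

section Main
open Relation
variable {V : Type*} [Fintype V] [DecidableEq V] {K : Type*} [Field K]

/-- The abstract data used in the proof. -/
structure Sys (E : V → V → Prop) (H Hs : Matrix V V K) (D : V → K) (S : Matrix V V K) :
    Prop where
  acyc : ∀ v, ¬ TransGen E v v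
  suppH : ∀ u v, ¬ E u v → H u v = 0
  suppHs : ∀ u v, ¬ E u v → Hs u v = 0
  neH : ∀ u v, E u v → H u v ≠ 0
  neHs : ∀ u v, E u v → Hs u v ≠ 0
  neD : ∀ v, D v ≠ 0
  row : ∀ x y, ¬ ReflTransGen E x y → S x y = ∑ u, H u x * S u y
  col : ∀ x y, ¬ ReflTransGen E y x → S x y = ∑ u, S x u * Hs u y
  diag : ∀ x, S x x = D x + ∑ u, H u x * S u x
  autD : ∀ w, ∃ τ : K →+* K, (∀ u v, τ (H u v) = H u v) ∧ (∀ u v, τ (Hs u v) = Hs u v) ∧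
    (∀ v, v ≠ w → τ (D v) = D v) ∧ τ (D w) = 2 * D w
  autH : ∀ u w, E u w → ∃ τ : K →+* K,
    (∀ a b, ¬ (a = u ∧ b = w) → τ (H a b) = H a b ∧ τ (Hs a b) = Hs a b) ∧
    (∀ v, τ (D v) = D v) ∧ τ (H u w) = 2 * H u w ∧ τ (Hs u w) = 2 * Hs u w

variable {E : V → V → Prop} {H Hs : Matrix V V K} {D : V → K} {S : Matrix V V K}

theorem anc_induction (hac : ∀ v, ¬ TransGen E v v) (P : Finset V → Prop) (h0 : P ∅)
    (hstep : ∀ (W : Finset V) (w : V), w ∉ W → (∀ a b, E a b → b ∈ W → a ∈ W) →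
      (∀ a, E a w → a ∈ W) → P W → P (insert w W)) :
    ∀ W : Finset V, (∀ a b, E a b → b ∈ W → a ∈ W) → P W := by
  intro W
  induction hn : W.card generalizing W with
  | zero =>
    intro _
    rw [Finset.card_eq_zero.1 hn]; exact h0
  | succ n ih =>
    intro hW
    have hne : W.Nonempty := Finset.card_pos.1 (by omega)
    have : IsStrictOrder V (fun a b => TransGen E b a) :=
      { irrefl := hac, trans := fun a b c h1 h2 => h2.trans h1 }
    have hwf : WellFounded (fun a b => TransGen E b a) := Finite.wellFounded_of_trans_of_irrefl _
    obtain ⟨w, hw, hmin⟩ := hwf.has_min (W : Set V) hne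
    have hsink : ∀ b ∈ W, ¬ E w b := fun b hb he => hmin b hb (TransGen.single he)
    have hanc : ∀ a b, E a b → b ∈ W.erase w → a ∈ W.erase w := by
      intro a b he hb
      rw [Finset.mem_erase] at hb ⊢
      refine ⟨?_, hW a b he hb.2⟩
      rintro rfl
      exact hsink b hb.2 he
    have := hstep (W.erase w) w (by simp) hanc ?_ (ih _ (by rw [Finset.card_erase_of_mem hw]; omega) hanc)
    · rwa [Finset.insert_erase hw] at this
    · intro a he
      rw [Finset.mem_erase]
      refine ⟨?_, hW a w he hw⟩
      rintro rfl
      exact hac _ (TransGen.single he)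

theorem not_reach_of_sink {W : Finset V} {w : V} (hw : w ∉ W)
    (hW : ∀ a b, E a b → b ∈ W → a ∈ W) {y : V} (hy : y ∈ W) : ¬ ReflTransGen E w y := by
  intro h
  apply hw
  induction h using ReflTransGen.head_induction_on with
  | refl => exact hy
  | head h _ ih =>
    exact hW _ _ h (ih (fun hc => hw (hW _ _ h hc)))

theorem Sys.fixS (h : Sys E H Hs D S) (τ : K →+* K) : ∀ W : Finset V,
    (∀ a b, E a b → b ∈ W → a ∈ W) → (∀ u, ∀ v ∈ W, τ (H u v) = H u v) →
    (∀ u, ∀ v ∈ W, τ (Hs u v) = Hs u v) → (∀ v ∈ W, τ (D v) = D v) →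
    ∀ x ∈ W, ∀ y ∈ W, τ (S x y) = S x y := by
  refine anc_induction h.acyc _ (by simp) ?_
  intro W w hw hW hpw ih h1 h2 h3
  have ih := ih (fun u v hv => h1 u v (by simp [hv])) (fun u v hv => h2 u v (by simp [hv]))
    (fun v hv => h3 v (by simp [hv]))
  have hcol : ∀ x ∈ W, τ (S x w) = S x w := by
    intro x hx
    rw [h.col x w (not_reach_of_sink hw hW hx), map_sum]
    refine Finset.sum_congr rfl fun u _ => ?_
    by_cases hu : E u w
    · rw [map_mul, ih x hx u (hpw u hu), h2 u w (by simp)]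
    · simp [h.suppHs u w hu]
  have hrow : ∀ y ∈ insert w W, τ (∑ u, H u w * S u y) = ∑ u, H u w * S u y := by
    intro y hy
    rw [map_sum]
    refine Finset.sum_congr rfl fun u _ => ?_
    by_cases hu : E u w
    · rw [map_mul, h1 u w (by simp)]
      rcases Finset.mem_insert.1 hy with rfl | hy
      · rw [hcol u (hpw u hu)]
      · rw [ih u (hpw u hu) y hy]
    · simp [h.suppH u w hu]
  intro x hx y hy
  rcases Finset.mem_insert.1 hx with rfl | hx'
  · rcases Finset.mem_insert.1 hy with rfl | hy'
    · rw [h.diag, map_add, hrow y hy, h3 y hy]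
    · rw [h.row x y (not_reach_of_sink hw hW hy'), hrow y hy]
  · rcases Finset.mem_insert.1 hy with rfl | hy
    · exact hcol x (by assumption)
    · exact ih x (by assumption) y hy

theorem sum_twist {ι : Type*} [Fintype ι] [DecidableEq ι] (τ : K →+* K) (c d : ι → K) (i : ι)
    (h1 : ∀ j, j ≠ i → τ (c j) = c j) (h2 : τ (c i) = 2 * c i)
    (hd : ∀ j, c j ≠ 0 → τ (d j) = d j) (hc : c i ≠ 0) (hsum : ∑ j, c j * d j = 0) : d i = 0 := by
  have h3 : ∑ j, (τ (c j * d j) - c j * d j) = 0 := by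
    rw [Finset.sum_sub_distrib, ← map_sum, hsum]; simp
  rw [Finset.sum_eq_single i] at h3
  · rw [map_mul, h2, hd i hc] at h3
    have : c i * d i = 0 := by linear_combination h3
    exact (mul_eq_zero.1 this).resolve_left hc
  · intro j _ hj
    by_cases hcj : c j = 0
    · simp [hcj]
    · rw [map_mul, h1 j hj, hd j hcj, sub_self]
  · simp

theorem Sys.main (h : Sys E H Hs D S) : ∀ W : Finset V,
    (∀ a b, E a b → b ∈ W → a ∈ W) → ∀ Z ⊆ W, ∃ C, Cnd S Z C ∧
      ∀ x ∈ W, ∀ y ∈ W, x ∉ Z → y ∉ Z → (C x y ≠ 0 ↔ Conn (fun a b => E a b ∧ b ∈ W) Z x y) := by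
  refine anc_induction h.acyc _ ?_ ?_
  · intro Z hZ
    rw [Finset.subset_empty.1 hZ]
    exact ⟨S, .nil, by simp⟩
  intro W w hw hW hpw ih
  have hEeq : (fun a b => (E a b ∧ b ∈ insert w W) ∧ b ≠ w) = (fun a b => E a b ∧ b ∈ W) := by
    funext a b
    simp only [Finset.mem_insert, eq_iff_iff]
    constructor
    · rintro ⟨⟨h1, h2 | h2⟩, h3⟩
      · exact absurd h2 h3
      · exact ⟨h1, h2⟩
    · rintro ⟨h1, h2⟩
      exact ⟨⟨h1, Or.inr h2⟩, by rintro rfl; exact hw h2⟩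
  have hsink : ∀ b, ¬ (E w b ∧ b ∈ insert w W) := by
    rintro b ⟨h1, h2⟩
    rcases Finset.mem_insert.1 h2 with rfl | h2
    · exact h.acyc _ (TransGen.single h1)
    · exact hw (hW _ _ h1 h2)
  -- the automorphism for `D w`
  obtain ⟨τ, hτH, hτHs, hτD, hτw⟩ := h.autD w
  have hτS := h.fixS τ W hW (fun u v _ => hτH u v) (fun u v _ => hτHs u v)
    (fun v hv => hτD v (by rintro rfl; exact hw hv))
  -- case `Z ⊆ W`
  have main : ∀ Z ⊆ W, ∃ C, Cnd S Z C ∧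
      (∀ x ∈ insert w W, ∀ y ∈ insert w W, x ∉ Z → y ∉ Z →
        (C x y ≠ 0 ↔ Conn (fun a b => E a b ∧ b ∈ insert w W) Z x y)) ∧
      (∃ r, C w w = D w + r ∧ τ r = r) ∧
      (∀ x ∈ W, τ (C x w) = C x w ∧ τ (C w x) = C w x ∧ ∀ y ∈ W, τ (C x y) = C x y) := by
    intro Z hZ
    obtain ⟨C, hC, hCC⟩ := ih Z hZ
    have hwZ : w ∉ Z := fun hh => hw (hZ hh)
    have hfix := hC.fix W τ hτS hZ
    have hrow : ∀ y ∈ W, C w y = ∑ u, H u w * C u y := by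
      intro y hy
      have := hC.lin_row w y (fun u => H u w) 0
        (fun b hb => h.row w b (not_reach_of_sink hw hW (hZ hb)))
        (by rw [zero_add]; exact h.row w y (not_reach_of_sink hw hW hy))
      rwa [zero_add] at this
    have hcol : ∀ x ∈ W, C x w = ∑ u, C x u * Hs u w := by
      intro x hx
      exact hC.lin_col x w (fun u => Hs u w)
        (fun b hb => h.col b w (not_reach_of_sink hw hW (hZ hb)))
        (h.col x w (not_reach_of_sink hw hW hx))
    have hdiag : C w w = D w + ∑ u, H u w * C u w :=
      hC.lin_row w w (fun u => H u w) (D w)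
        (fun b hb => h.row w b (not_reach_of_sink hw hW (hZ hb))) (h.diag w)
    have hτcol : ∀ x ∈ W, τ (C x w) = C x w := by
      intro x hx
      rw [hcol x hx, map_sum]
      refine Finset.sum_congr rfl fun u _ => ?_
      by_cases hu : E u w
      · rw [map_mul, hfix x hx u (hpw u hu), hτHs]
      · simp [h.suppHs u w hu]
    have hτrow : ∀ x ∈ W, τ (C w x) = C w x := by
      intro x hx
      rw [hrow x hx, map_sum]
      refine Finset.sum_congr rfl fun u _ => ?_
      by_cases hu : E u w
      · rw [map_mul, hfix u (hpw u hu) x hx, hτH]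
      · simp [h.suppH u w hu]
    have hτr : τ (∑ u, H u w * C u w) = ∑ u, H u w * C u w := by
      rw [map_sum]
      refine Finset.sum_congr rfl fun u _ => ?_
      by_cases hu : E u w
      · rw [map_mul, hτcol u (hpw u hu), hτH]
      · simp [h.suppH u w hu]
    refine ⟨C, hC, ?_, ⟨_, hdiag, hτr⟩, fun x hx => ⟨hτcol x hx, hτrow x hx, hfix x hx⟩⟩
    intro x hx y hy hxZ hyZ
    have hWne : ∀ {v}, v ∈ W → v ≠ w := by
      rintro v hv rfl; exact hw hv
    rcases Finset.mem_insert.1 hx with rfl | hxW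
    · rcases Finset.mem_insert.1 hy with rfl | hyW
      · refine ⟨fun _ => ⟨_, .start⟩, fun _ hzero => h.neD y ?_⟩
        rw [hdiag] at hzero
        have h2 := congrArg τ hzero
        rw [map_add, hτr, hτw, map_zero] at h2
        linear_combination h2 - hzero
      · rw [conn_B hsink hwZ (hWne hyW), hEeq]
        constructor
        · intro hne
          rw [hrow y hyW] at hne
          obtain ⟨u, _, hu⟩ := Finset.exists_ne_zero_of_sum_ne_zero hne
          have huE : E u x := by
            by_contra hE
            exact hu (by rw [h.suppH u x hE, zero_mul])
          have huZ : u ∉ Z := fun hh => hu (by rw [(hC.vanish u hh y).2, mul_zero])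
          exact ⟨u, ⟨huE, by simp⟩, huZ,
            (hCC u (hpw u huE) y hyW huZ hyZ).1 (right_ne_zero_of_mul hu)⟩
        · rintro ⟨u, ⟨huE, _⟩, huZ, hconn⟩ hzero
          apply (hCC u (hpw u huE) y hyW huZ hyZ).2 hconn
          obtain ⟨ρ, hρ1, hρD, hρH, _⟩ := h.autH u x huE
          have hρS := h.fixS ρ W hW
            (fun a b hb => (hρ1 a b (fun hh => hWne hb hh.2)).1)
            (fun a b hb => (hρ1 a b (fun hh => hWne hb hh.2)).2) (fun v _ => hρD v)
          have hρC := hC.fix W ρ hρS hZ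
          rw [hrow y hyW] at hzero
          refine sum_twist ρ (fun a => H a x) (fun a => C a y) u
            (fun a ha => (hρ1 a x (fun hh => ha hh.1)).1) hρH ?_ (h.neH u x huE) hzero
          intro a ha
          have haE : E a x := by
            by_contra hE
            exact ha (h.suppH a x hE)
          exact hρC a (hpw a haE) y hyW
    · rcases Finset.mem_insert.1 hy with rfl | hyW
      · rw [conn_C hsink hwZ (hWne hxW) hxZ, hEeq]
        constructor
        · intro hne
          rw [hcol x hxW] at hne
          obtain ⟨u, _, hu⟩ := Finset.exists_ne_zero_of_sum_ne_zero hne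
          have huE : E u y := by
            by_contra hE
            exact hu (by rw [h.suppHs u y hE, mul_zero])
          have huZ : u ∉ Z := fun hh => hu (by rw [(hC.vanish u hh x).1, zero_mul])
          exact ⟨u, ⟨huE, by simp⟩, huZ,
            (hCC x hxW u (hpw u huE) hxZ huZ).1 (left_ne_zero_of_mul hu)⟩
        · rintro ⟨u, ⟨huE, _⟩, huZ, hconn⟩ hzero
          apply (hCC x hxW u (hpw u huE) hxZ huZ).2 hconn
          obtain ⟨ρ, hρ1, hρD, _, hρH⟩ := h.autH u y huE
          have hρS := h.fixS ρ W hW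
            (fun a b hb => (hρ1 a b (fun hh => hWne hb hh.2)).1)
            (fun a b hb => (hρ1 a b (fun hh => hWne hb hh.2)).2) (fun v _ => hρD v)
          have hρC := hC.fix W ρ hρS hZ
          rw [hcol x hxW] at hzero
          simp_rw [mul_comm (C x _)] at hzero
          refine sum_twist ρ (fun a => Hs a y) (fun a => C x a) u
            (fun a ha => (hρ1 a y (fun hh => ha hh.1)).2) hρH ?_ (h.neHs u y huE) hzero
          intro a ha
          have haE : E a y := by
            by_contra hE
            exact ha (h.suppHs a y hE)
          exact hρC x hxW a (hpw a haE)
      · rw [conn_A hsink hwZ (hWne hxW) (hWne hyW), hEeq]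
        exact hCC x hxW y hyW hxZ hyZ
  intro Z hZ
  by_cases hwZ : w ∈ Z
  · obtain ⟨C, hC, hCC, ⟨r, hr, hτr⟩, hfix⟩ := main (Z.erase w) (by
      intro a ha
      rw [Finset.mem_erase] at ha
      exact (Finset.mem_insert.1 (hZ ha.2)).resolve_left ha.1)
    have hwe : w ∉ Z.erase w := by simp
    have hww : C w w ≠ 0 :=
      (hCC w (by simp) w (by simp) hwe hwe).2 ⟨_, .start⟩
    have hC' := hC.step hwe hww
    rw [Finset.insert_erase hwZ] at hC'
    refine ⟨_, hC', ?_⟩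
    intro x hx y hy hxZ hyZ
    have hxw : x ≠ w := by rintro rfl; exact hxZ hwZ
    have hyw : y ≠ w := by rintro rfl; exact hyZ hwZ
    have hxW := (Finset.mem_insert.1 hx).resolve_left hxw
    have hyW := (Finset.mem_insert.1 hy).resolve_left hyw
    have hxe : x ∉ Z.erase w := by simp [hxZ]
    have hye : y ∉ Z.erase w := by simp [hyZ]
    have hD := conn_D (E := fun a b => E a b ∧ b ∈ insert w W) hsink hwe hxw hyw hxe
    rw [Finset.insert_erase hwZ] at hD
    rw [hD, ← hCC x hx y hy hxe hye, ← hCC x hx w (by simp) hxe hwe,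
      ← hCC w (by simp) y hy hwe hye]
    constructor
    · intro hne
      by_contra hcon
      push Not at hcon
      apply hne
      rw [hcon.1]
      by_cases h1 : C x w = 0
      · simp [h1]
      · simp [hcon.2 h1]
    · intro hor hzero
      have h1 : C x y * (D w + r) = C x w * C w y := by
        rw [← hr]
        field_simp at hzero
        linear_combination hzero
      have h2 := congrArg τ h1
      rw [map_mul, map_mul, map_add, hτr, hτw, (hfix x hxW).1, (hfix y hyW).2.1,
        (hfix x hxW).2.2 y hyW] at h2
      have h3 : C x y * D w = 0 := by linear_combination h2 - h1
      have h4 : C x y = 0 := (mul_eq_zero.1 h3).resolve_right (h.neD w)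
      rw [h4, zero_mul] at h1
      rcases hor with h5 | ⟨h5, h6⟩
      · exact h5 h4
      · exact mul_ne_zero h5 h6 h1.symm
  · obtain ⟨C, hC, hCC, _⟩ := main Z (by
      intro a ha
      refine (Finset.mem_insert.1 (hZ ha)).resolve_left ?_
      rintro rfl; exact hwZ ha)
    exact ⟨C, hC, hCC⟩

theorem one_sub_isUnit (hac : ∀ v, ¬ TransGen E v v) (M : Matrix V V K)
    (hM : ∀ u v, ¬ E u v → M u v = 0) : IsUnit (1 - M) := by
  rw [← Matrix.mulVec_injective_iff_isUnit]
  refine (injective_iff_map_eq_zero (Matrix.mulVecLin _)).2 fun v hv => ?_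
  have hwf : WellFounded (fun a b => TransGen E b a) :=
    have : IsStrictOrder V (fun a b => TransGen E b a) :=
      { irrefl := hac, trans := fun a b c h1 h2 => h2.trans h1 }
    Finite.wellFounded_of_trans_of_irrefl _
  ext x
  induction x using hwf.induction with
  | _ x ih =>
    have := congrFun hv x
    rw [Matrix.mulVecLin_apply, Matrix.sub_mulVec, Matrix.one_mulVec, Pi.sub_apply] at this
    have h2 : (M *ᵥ v) x = 0 := by
      refine Finset.sum_eq_zero fun u _ => ?_
      by_cases hu : E x u
      · rw [ih u (TransGen.single hu), Pi.zero_apply, mul_zero]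
      · change M x u * v u = 0
        rw [hM x u hu, zero_mul]
    rw [h2, sub_zero] at this
    exact this

theorem inv_entries (hac : ∀ v, ¬ TransGen E v v) (M : Matrix V V K)
    (hM : ∀ u v, ¬ E u v → M u v = 0) :
    (∀ x y, ¬ ReflTransGen E x y → (1 - M)⁻¹ x y = 0) ∧ ∀ x, (1 - M)⁻¹ x x = 1 := by
  have hu := (Matrix.isUnit_iff_isUnit_det _).1 (one_sub_isUnit hac M hM)
  have hN : (1 - M)⁻¹ = 1 + M * (1 - M)⁻¹ := by
    have := Matrix.mul_nonsing_inv _ hu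
    rw [Matrix.sub_mul, Matrix.one_mul, sub_eq_iff_eq_add] at this
    exact this
  have hwf : WellFounded (fun a b => TransGen E b a) :=
    have : IsStrictOrder V (fun a b => TransGen E b a) :=
      { irrefl := hac, trans := fun a b c h1 h2 => h2.trans h1 }
    Finite.wellFounded_of_trans_of_irrefl _
  have h1 : ∀ x y, ¬ ReflTransGen E x y → (1 - M)⁻¹ x y = 0 := by
    intro x y
    induction x using hwf.induction with
    | _ x ih =>
      intro hxy
      have hne : x ≠ y := by rintro rfl; exact hxy .refl
      rw [hN, Matrix.add_apply, Matrix.one_apply_ne hne, zero_add, Matrix.mul_apply]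
      refine Finset.sum_eq_zero fun u _ => ?_
      by_cases hu : E x u
      · rw [ih u (TransGen.single hu) (fun h => hxy (h.head hu)), mul_zero]
      · rw [hM x u hu, zero_mul]
  refine ⟨h1, fun x => ?_⟩
  rw [hN, Matrix.add_apply, Matrix.one_apply_eq, Matrix.mul_apply, Finset.sum_eq_zero, add_zero]
  intro u _
  by_cases hu : E x u
  · rw [h1 u x (fun h => hac x (TransGen.head' hu h)), mul_zero]
  · rw [hM x u hu, zero_mul]

theorem spec_facts (hac : ∀ v, ¬ TransGen E v v) (A B : Matrix V V K) (D : V → K)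
    (hA : ∀ u v, ¬ E u v → A u v = 0) (hB : ∀ u v, ¬ E u v → B u v = 0) (S : Matrix V V K)
    (hS : S = ((1 - A)ᵀ)⁻¹ * Matrix.diagonal D * (1 - B)⁻¹) :
    (∀ x y, ¬ ReflTransGen E x y → S x y = ∑ u, A u x * S u y) ∧
    (∀ x y, ¬ ReflTransGen E y x → S x y = ∑ u, S x u * B u y) ∧
    (∀ x, S x x = D x + ∑ u, A u x * S u x) := by
  have huA := (Matrix.isUnit_iff_isUnit_det _).1 (one_sub_isUnit hac A hA)
  have huB := (Matrix.isUnit_iff_isUnit_det _).1 (one_sub_isUnit hac B hB)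
  have h1 : (1 - A)ᵀ * S = Matrix.diagonal D * (1 - B)⁻¹ := by
    rw [hS, Matrix.mul_assoc, Matrix.mul_nonsing_inv_cancel_left]
    rwa [Matrix.det_transpose]
  have h2 : S * (1 - B) = ((1 - A)⁻¹)ᵀ * Matrix.diagonal D := by
    rw [hS, Matrix.nonsing_inv_mul_cancel_right _ _ huB, Matrix.transpose_nonsing_inv]
  have h1' : ∀ x y, S x y - ∑ u, A u x * S u y = D x * (1 - B)⁻¹ x y := by
    intro x y
    have := congrFun (congrFun h1 x) y
    rw [Matrix.transpose_sub, Matrix.transpose_one, Matrix.sub_mul, Matrix.one_mul,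
      Matrix.diagonal_mul] at this
    rw [← this]
    rfl
  have h2' : ∀ x y, S x y - ∑ u, S x u * B u y = (1 - A)⁻¹ y x * D y := by
    intro x y
    have := congrFun (congrFun h2 x) y
    rw [Matrix.mul_sub, Matrix.mul_one, Matrix.mul_diagonal] at this
    rw [Matrix.transpose_apply] at this
    rw [← this]
    rfl
  obtain ⟨hA1, hA2⟩ := inv_entries hac A hA
  obtain ⟨hB1, hB2⟩ := inv_entries hac B hB
  refine ⟨fun x y hxy => ?_, fun x y hxy => ?_, fun x => ?_⟩
  · have := h1' x y
    rwa [hB1 x y hxy, mul_zero, sub_eq_zero] at this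
  · have := h2' x y
    rwa [hA1 y x hxy, zero_mul, sub_eq_zero] at this
  · have := h1' x x
    rw [hB2, mul_one] at this
    linear_combination this

end Main
section Param
variable {V : Type*}

/-- Rescaling the indeterminates by nonzero reals induces an endomorphism of the field. -/
theorem exists_scale (c : GVar V → ℝ) (hc : ∀ i, c i ≠ 0) :
    ∃ τ : GField V →+* GField V, ∀ i, τ (gv i) = gconst (c i) * gv i := by
  let f : MvPolynomial (GVar V) ℝ →ₐ[ℝ] MvPolynomial (GVar V) ℝ :=
    MvPolynomial.aeval fun i => MvPolynomial.C (c i) * MvPolynomial.X i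
  let g : MvPolynomial (GVar V) ℝ →ₐ[ℝ] MvPolynomial (GVar V) ℝ :=
    MvPolynomial.aeval fun i => MvPolynomial.C (c i)⁻¹ * MvPolynomial.X i
  have hgf : g.comp f = AlgHom.id ℝ _ := by
    ext1 i
    simp only [f, g, AlgHom.comp_apply, MvPolynomial.aeval_X, map_mul, MvPolynomial.algHom_C,
      AlgHom.id_apply, MvPolynomial.algebraMap_eq]
    rw [← mul_assoc, ← MvPolynomial.C_mul, mul_inv_cancel₀ (hc i), MvPolynomial.C_1, one_mul]
  have hinj : Function.Injective f := by
    intro p q hpq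
    have h1 := DFunLike.congr_fun hgf p
    have h2 := DFunLike.congr_fun hgf q
    simp only [AlgHom.comp_apply, AlgHom.id_apply] at h1 h2
    rw [← h1, hpq, h2]
  have hinj2 : Function.Injective
      ((algebraMap (MvPolynomial (GVar V) ℝ) (GField V)).comp f.toRingHom) :=
    (IsFractionRing.injective (MvPolynomial (GVar V) ℝ) (GField V)).comp hinj
  refine ⟨IsFractionRing.lift hinj2, fun i => ?_⟩
  unfold gv gconst
  rw [IsFractionRing.lift_algebraMap, ← map_mul]
  simp [f]

theorem gconst_one : (gconst 1 : GField V) = 1 := by simp [gconst]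

theorem gconst_two : (gconst 2 : GField V) = 2 := by
  have : (MvPolynomial.C 2 : MvPolynomial (GVar V) ℝ) = 2 := map_ofNat _ 2
  rw [gconst, this, map_ofNat]

/-- Polynomial version of the lag polynomial. -/
theorem lagPoly_eq (Kf : V × V → Finset ℕ) (v w : V) :
    lagPoly Kf v w = algebraMap (MvPolynomial (GVar V) ℝ) (GField V)
      (∑ k ∈ Kf (v, w), MvPolynomial.X (GVar.phi v w k) * MvPolynomial.X GVar.z ^ k) := by
  simp [lagPoly, gv]

theorem lagPoly_ne_zero (Kf : V × V → Finset ℕ) (v w : V) (h : (Kf (v, w)).Nonempty) :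
    lagPoly Kf v w ≠ 0 := by
  rw [lagPoly_eq]
  intro h0
  rw [map_eq_zero_iff _ (IsFractionRing.injective (MvPolynomial (GVar V) ℝ) (GField V))] at h0
  have := congrArg (MvPolynomial.eval fun _ => (1 : ℝ)) h0
  simp at this
  exact h.ne_empty this

theorem one_sub_lagPoly_ne_zero (Kf : V × V → Finset ℕ) (v w : V) :
    1 - lagPoly Kf v w ≠ 0 := by
  rw [lagPoly_eq, ← map_one (algebraMap (MvPolynomial (GVar V) ℝ) (GField V)), ← map_sub]
  intro h0
  rw [map_eq_zero_iff _ (IsFractionRing.injective (MvPolynomial (GVar V) ℝ) (GField V))] at h0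
  have := congrArg (MvPolynomial.eval fun _ => (0 : ℝ)) h0
  simp at this

theorem gv_ne_zero (i : GVar V) : gv i ≠ 0 := by
  unfold gv
  intro h0
  rw [map_eq_zero_iff _ (IsFractionRing.injective (MvPolynomial (GVar V) ℝ) (GField V))] at h0
  exact MvPolynomial.X_ne_zero i h0

theorem tau_lag (τ : GField V →+* GField V) (Kf : V × V → Finset ℕ) (a b : V) (s : GField V)
    (hz : τ (gv GVar.z) = gv GVar.z)
    (hφ : ∀ k, τ (gv (GVar.phi a b k)) = s * gv (GVar.phi a b k))
    (σ : GField V ≃+* GField V)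
    (hσz : σ (gv (GVar.z : GVar V)) = (gv (GVar.z : GVar V))⁻¹)
    (hσφ : ∀ (v w : V) (k : ℕ), σ (gv (GVar.phi v w k)) = gv (GVar.phi v w k)) :
    τ (lagPoly Kf a b) = s * lagPoly Kf a b ∧
      τ (σ (lagPoly Kf a b)) = s * σ (lagPoly Kf a b) := by
  constructor
  · simp only [lagPoly, map_sum, map_mul, map_pow, hz, hφ, Finset.mul_sum, mul_assoc]
  · simp only [lagPoly, map_sum, map_mul, map_pow, hσz, hσφ, map_inv₀, hz, hφ, Finset.mul_sum,
      mul_assoc]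

theorem param_sys [Fintype V] [DecidableEq V]
    (DO : Finset (V × V)) (hDO : ∀ p ∈ DO, p.1 ≠ p.2)
    (hacyc : ∀ v : V, ¬ Relation.TransGen (fun v w => (v, w) ∈ DO) v v)
    (Kf : V × V → Finset ℕ)
    (hKedge : ∀ p ∈ DO, (Kf p).Nonempty)
    (σ : GField V ≃+* GField V)
    (hσz : σ (gv (GVar.z : GVar V)) = (gv (GVar.z : GVar V))⁻¹)
    (hσφ : ∀ (v w : V) (k : ℕ), σ (gv (GVar.phi v w k)) = gv (GVar.phi v w k)) :
    Sys (fun v w => (v, w) ∈ DO) (Hmat DO Kf) ((Hmat DO Kf).map σ)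
      (fun v => gv (GVar.omega v) / ((1 - lagPoly Kf v v) * σ (1 - lagPoly Kf v v)))
      (Smat DO Kf σ) := by
  have hs : ∀ u v, (u, v) ∉ DO → Hmat DO Kf u v = 0 := fun u v h => by simp [Hmat, h]
  have hs' : ∀ u v, (u, v) ∉ DO → (Hmat DO Kf).map σ u v = 0 := fun u v h => by
    simp [hs u v h]
  have hne : ∀ u v, (u, v) ∈ DO → Hmat DO Kf u v ≠ 0 := fun u v h => by
    simp only [Hmat, h, if_true]
    exact div_ne_zero (lagPoly_ne_zero _ _ _ (hKedge _ h)) (one_sub_lagPoly_ne_zero _ _ _)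
  obtain ⟨h1, h2, h3⟩ := spec_facts hacyc (Hmat DO Kf) ((Hmat DO Kf).map σ)
    (fun v => gv (GVar.omega v) / ((1 - lagPoly Kf v v) * σ (1 - lagPoly Kf v v)))
    hs hs' (Smat DO Kf σ) rfl
  refine ⟨hacyc, hs, hs', hne, ?_, ?_, h1, h2, h3, ?_, ?_⟩
  · intro u v h
    rw [Matrix.map_apply]
    exact (map_ne_zero σ).2 (hne u v h)
  · intro v
    have := one_sub_lagPoly_ne_zero Kf v v
    exact div_ne_zero (gv_ne_zero _) (mul_ne_zero this ((map_ne_zero σ).2 this))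
  · intro w
    classical
    obtain ⟨τ, hτ⟩ := exists_scale (V := V) (fun i => if i = GVar.omega w then 2 else 1)
      (fun i => by split_ifs <;> norm_num)
    have hl : ∀ a b, τ (lagPoly Kf a b) = lagPoly Kf a b ∧
        τ (σ (lagPoly Kf a b)) = σ (lagPoly Kf a b) := by
      intro a b
      have := tau_lag τ Kf a b 1 (by simp [hτ, gconst_one]) (by simp [hτ, gconst_one]) σ hσz hσφ
      simpa using this
    refine ⟨τ, ?_, ?_, ?_, ?_⟩
    · intro u v
      by_cases h : (u, v) ∈ DO <;> simp [Hmat, h, hl]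
    · intro u v
      by_cases h : (u, v) ∈ DO <;> simp [Hmat, h, hl]
    · intro v hv
      simp [hl, hτ, hv, gconst_one]
    · simp [hl, hτ, gconst_two, mul_div_assoc]
  · intro u w huw
    classical
    obtain ⟨τ, hτ⟩ := exists_scale (V := V)
      (fun i => if ∃ k, i = GVar.phi u w k then 2 else 1)
      (fun i => by split_ifs <;> norm_num)
    have hl : ∀ a b, ¬ (a = u ∧ b = w) → τ (lagPoly Kf a b) = lagPoly Kf a b ∧
        τ (σ (lagPoly Kf a b)) = σ (lagPoly Kf a b) := by
      intro a b hab
      have := tau_lag τ Kf a b 1 (by simp [hτ, gconst_one]) (fun k => by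
        rw [hτ, if_neg, gconst_one]
        rintro ⟨k', hk⟩
        injection hk with h1 h2
        exact hab ⟨h1, h2⟩) σ hσz hσφ
      simpa using this
    have hl2 := tau_lag τ Kf u w 2 (by simp [hτ, gconst_one]) (by simp [hτ, gconst_two]) σ hσz hσφ
    have hself : ∀ v, τ (lagPoly Kf v v) = lagPoly Kf v v ∧
        τ (σ (lagPoly Kf v v)) = σ (lagPoly Kf v v) :=
      fun v => hl v v (fun h => hDO _ huw (h.1.symm.trans h.2))
    refine ⟨τ, ?_, ?_, ?_, ?_⟩
    · intro a b hab
      by_cases h : (a, b) ∈ DO <;> simp [Hmat, h, hl a b hab, hself]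
    · intro v
      simp [hself, hτ, gconst_one]
    · simp [Hmat, huw, hself, hl2, mul_div_assoc]
    · simp [Hmat, huw, hself, hl2, mul_div_assoc]

end Param

/-- in the generic frequency-domain parameterisation of an acyclic process
graph `G = (V, D)`, for pairwise disjoint `X, Y, Z ⊆ V`, the submatrix `[S]_{Z,Z}` is
invertible over `𝕂`, and the conditional spectrum
`[S]_{X,Y|Z} = [S]_{X,Y} − [S]_{X,Z}·[S]_{Z,Z}⁻¹·[S]_{Z,Y}` is the zero matrix over `𝕂` if
and only if `Z` d-separates `X` and `Y` in `G`. -/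
theorem conditional_spectrum_eq_zero_iff_dsep
    {V : Type u} [Fintype V] [DecidableEq V]
    (DO : Finset (V × V)) (hDO : ∀ p ∈ DO, p.1 ≠ p.2)
    (hacyc : ∀ v : V, ¬ Relation.TransGen (fun v w => (v, w) ∈ DO) v v)
    (Kf : V × V → Finset ℕ)
    (hKedge : ∀ p ∈ DO, (Kf p).Nonempty)
    (hKself : ∀ v : V, 0 ∉ Kf (v, v))
    (σ : GField V ≃+* GField V)
    (hσz : σ (gv (GVar.z : GVar V)) = (gv (GVar.z : GVar V))⁻¹)
    (hσφ : ∀ (v w : V) (k : ℕ), σ (gv (GVar.phi v w k)) = gv (GVar.phi v w k))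
    (hσω : ∀ v : V, σ (gv (GVar.omega v)) = gv (GVar.omega v))
    (hσR : ∀ a : ℝ, σ (gconst a) = (gconst a : GField V))
    (X Y Z : Finset V)
    (hXY : Disjoint X Y) (hXZ : Disjoint X Z) (hYZ : Disjoint Y Z) :
    IsUnit ((Smat DO Kf σ).submatrix (fun a : {u // u ∈ Z} => (a : V))
      (fun b : {u // u ∈ Z} => (b : V))) ∧
    (((Smat DO Kf σ).submatrix (fun a : {u // u ∈ X} => (a : V))
          (fun b : {u // u ∈ Y} => (b : V)) -
        (Smat DO Kf σ).submatrix (fun a : {u // u ∈ X} => (a : V))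
            (fun b : {u // u ∈ Z} => (b : V)) *
          ((Smat DO Kf σ).submatrix (fun a : {u // u ∈ Z} => (a : V))
              (fun b : {u // u ∈ Z} => (b : V)))⁻¹ *
          (Smat DO Kf σ).submatrix (fun a : {u // u ∈ Z} => (a : V))
            (fun b : {u // u ∈ Y} => (b : V)) = 0) ↔
      DSep (fun v w => (v, w) ∈ DO) X Y Z) := by
  have hsys := param_sys DO hDO hacyc Kf hKedge σ hσz hσφ
  obtain ⟨C, hC, hCC⟩ := hsys.main Finset.univ (by simp) Z (by simp)
  refine ⟨hC.isUnit, ?_⟩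
  rw [hC.formula X Y, dsep_iff hacyc X Y (fun y hy => Finset.disjoint_left.1 hYZ hy)]
  have hE : (fun a b => (a, b) ∈ DO ∧ b ∈ (Finset.univ : Finset V)) =
      (fun v w => (v, w) ∈ DO) := by
    funext a b; simp
  rw [hE] at hCC
  constructor
  · intro h x hx y hy hconn
    have h1 := congrFun (congrFun h ⟨x, hx⟩) ⟨y, hy⟩
    exact (hCC x (by simp) y (by simp) (Finset.disjoint_left.1 hXZ hx)
      (Finset.disjoint_left.1 hYZ hy)).2 hconn h1
  · intro h
    ext x y
    by_contra hne
    exact h x x.2 y y.2 ((hCC x (by simp) y (by simp) (Finset.disjoint_left.1 hXZ x.2)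
      (Finset.disjoint_left.1 hYZ y.2)).1 hne)
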